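/- arXiv:2408.00581 — 2 statements merged into one kernel-verified Lean document; each statement's English description precedes it below -/
import Mathlib

section
/- Suppose there exists a symmetric positive definite matrix X ∈ ℝ^{n×n} such that L(X) is negative definite (equivalently, L(X) = −Y for some symmetric positive definite Y). Then there exists ε > 0 such that the matrix P := (εX)^{-1} is symmetric positive definite, U(P^{-1}) = U(εX) is positive definite, and L(P^{-1}) + S(P^{-1}) · U(P^{-1})^{-1} · S(P^{-1})ᵀ is negative semidefinite. In other words, a reachability Gramian exists: a symmetric positive definite P with U(P^{-1}) positive definite satisfying L(P^{-1}) + S(P^{-1}) U(P^{-1})^{-1} S(P^{-1})ᵀ ≤ 0. -/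
open Matrix

/-- The operator `L(X) = AᵀX + XA + Σ_{i,j} k_{ij} N_iᵀ X N_j`. -/
noncomputable def Lop {n q : ℕ} (A : Matrix (Fin n) (Fin n) ℝ)
    (N : Fin q → Matrix (Fin n) (Fin n) ℝ) (K : Matrix (Fin q) (Fin q) ℝ)
    (X : Matrix (Fin n) (Fin n) ℝ) : Matrix (Fin n) (Fin n) ℝ :=
  Aᵀ * X + X * A + ∑ i, ∑ j, K i j • ((N i)ᵀ * X * N j)

/-- The operator `S(X) = XB + Σ_{i,j} k_{ij} N_iᵀ X M_j`. -/
noncomputable def Sop {n m q : ℕ} (B : Matrix (Fin n) (Fin m) ℝ)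
    (N : Fin q → Matrix (Fin n) (Fin n) ℝ) (M : Fin q → Matrix (Fin n) (Fin m) ℝ)
    (K : Matrix (Fin q) (Fin q) ℝ) (X : Matrix (Fin n) (Fin n) ℝ) : Matrix (Fin n) (Fin m) ℝ :=
  X * B + ∑ i, ∑ j, K i j • ((N i)ᵀ * X * M j)

/-- The operator `U(X) = γ I_m − Σ_{i,j} k_{ij} M_iᵀ X M_j`. -/
noncomputable def Uop {n m q : ℕ} (γ : ℝ) (M : Fin q → Matrix (Fin n) (Fin m) ℝ)
    (K : Matrix (Fin q) (Fin q) ℝ) (X : Matrix (Fin n) (Fin n) ℝ) : Matrix (Fin m) (Fin m) ℝ :=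
  γ • (1 : Matrix (Fin m) (Fin m) ℝ) - ∑ i, ∑ j, K i j • ((M i)ᵀ * X * M j)

open Filter Topology

/-- Positive definiteness is an open condition among Hermitian matrices. -/
theorem Matrix.PosDef.eventually_of_tendsto {ι α : Type*} [Fintype ι] {l : Filter α}
    {F : α → Matrix ι ι ℝ} {Y : Matrix ι ι ℝ} (hY : Y.PosDef)
    (hF : Tendsto F l (𝓝 Y)) (hH : ∀ a, (F a).IsHermitian) :
    ∀ᶠ a in l, (F a).PosDef := by
  have hopen : IsOpen {p : Matrix ι ι ℝ × (ι → ℝ) | 0 < p.2 ⬝ᵥ (p.1 *ᵥ p.2)} :=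
    isOpen_lt continuous_const
      (continuous_snd.dotProduct (continuous_fst.matrix_mulVec continuous_snd))
  have hsphere : ∀ᶠ Z in 𝓝 Y, ∀ x ∈ Metric.sphere (0 : ι → ℝ) 1, 0 < x ⬝ᵥ (Z *ᵥ x) := by
    refine (isCompact_sphere (0 : ι → ℝ) 1).eventually_forall_of_forall_eventually
      fun x hx => hopen.mem_nhds ?_
    have hx0 : x ≠ 0 := by
      rintro rfl
      simp at hx
    simpa using hY.dotProduct_mulVec_pos hx0
  filter_upwards [hF.eventually hsphere] with a ha
  refine PosDef.of_dotProduct_mulVec_pos (hH a) fun x hx => ?_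
  have hnx : 0 < ‖x‖ := norm_pos_iff.mpr hx
  have h := ha (‖x‖⁻¹ • x) (by simp [norm_smul, hnx.ne'])
  rw [mulVec_smul, smul_dotProduct, dotProduct_smul, smul_eq_mul, smul_eq_mul] at h
  have hinv : 0 < ‖x‖⁻¹ := inv_pos.mpr hnx
  simpa using pos_of_mul_pos_right (pos_of_mul_pos_right h hinv.le) hinv.le

theorem isHermitian_sum_smul_transpose_mul_mul {n m q : ℕ}
    (M : Fin q → Matrix (Fin n) (Fin m) ℝ) {K : Matrix (Fin q) (Fin q) ℝ} (hK : K.IsHermitian)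
    {X : Matrix (Fin n) (Fin n) ℝ} (hX : X.IsHermitian) :
    (∑ i, ∑ j, K i j • ((M i)ᵀ * X * M j)).IsHermitian := by
  have hX' : Xᵀ = X := by simpa using hX.eq
  have hK' : ∀ i j, K i j = K j i := fun i j => by simpa using (hK.apply i j).symm
  rw [IsHermitian, conjTranspose_eq_transpose_of_trivial]
  simp only [transpose_sum, transpose_smul, transpose_mul, transpose_transpose, hX',
    ← Matrix.mul_assoc]
  rw [Finset.sum_comm]
  simp only [hK']

theorem Uop_isHermitian {n m q : ℕ} (γ : ℝ) (M : Fin q → Matrix (Fin n) (Fin m) ℝ)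
    {K : Matrix (Fin q) (Fin q) ℝ} (hK : K.IsHermitian)
    {X : Matrix (Fin n) (Fin n) ℝ} (hX : X.IsHermitian) : (Uop γ M K X).IsHermitian :=
  (isHermitian_one.smul (.all γ)).sub (isHermitian_sum_smul_transpose_mul_mul M hK hX)

theorem Lop_smul {n q : ℕ} (A : Matrix (Fin n) (Fin n) ℝ)
    (N : Fin q → Matrix (Fin n) (Fin n) ℝ) (K : Matrix (Fin q) (Fin q) ℝ) (c : ℝ)
    (X : Matrix (Fin n) (Fin n) ℝ) : Lop A N K (c • X) = c • Lop A N K X := by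
  simp [Lop, Finset.smul_sum, smul_comm c]

theorem Sop_smul {n m q : ℕ} (B : Matrix (Fin n) (Fin m) ℝ)
    (N : Fin q → Matrix (Fin n) (Fin n) ℝ) (M : Fin q → Matrix (Fin n) (Fin m) ℝ)
    (K : Matrix (Fin q) (Fin q) ℝ) (c : ℝ) (X : Matrix (Fin n) (Fin n) ℝ) :
    Sop B N M K (c • X) = c • Sop B N M K X := by
  simp [Sop, Finset.smul_sum, smul_comm c]

theorem continuous_Uop {n m q : ℕ} (γ : ℝ) (M : Fin q → Matrix (Fin n) (Fin m) ℝ)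
    (K : Matrix (Fin q) (Fin q) ℝ) : Continuous (Uop γ M K) := by
  unfold Uop
  fun_prop

/-- If there is a symmetric positive definite `X` with `L(X)` negative definite,
then there is `ε > 0` such that `P := (εX)⁻¹` is symmetric positive definite, `U(P⁻¹)` is
positive definite, and `L(P⁻¹) + S(P⁻¹) U(P⁻¹)⁻¹ S(P⁻¹)ᵀ ≤ 0`; i.e. a reachability Gramian
exists. -/
theorem reachability_gramian_exists {n m q : ℕ} [NeZero n] [NeZero m] [NeZero q]
    (A : Matrix (Fin n) (Fin n) ℝ) (N : Fin q → Matrix (Fin n) (Fin n) ℝ)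
    (B : Matrix (Fin n) (Fin m) ℝ) (M : Fin q → Matrix (Fin n) (Fin m) ℝ)
    (K : Matrix (Fin q) (Fin q) ℝ) (hK : K.PosSemidef)
    (γ : ℝ) (hγ : 0 < γ)
    (X : Matrix (Fin n) (Fin n) ℝ) (hX : X.PosDef)
    (hLX : (-(Lop A N K X)).PosDef) :
    ∃ ε : ℝ, 0 < ε ∧
      ((ε • X)⁻¹).PosDef ∧
      (Uop γ M K ((ε • X)⁻¹)⁻¹).PosDef ∧
      (-(Lop A N K ((ε • X)⁻¹)⁻¹ +
          Sop B N M K ((ε • X)⁻¹)⁻¹ * (Uop γ M K ((ε • X)⁻¹)⁻¹)⁻¹ *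
            (Sop B N M K ((ε • X)⁻¹)⁻¹)ᵀ)).PosSemidef := by
  have hK' := hK.isHermitian
  have hXε (ε : ℝ) : (ε • X).IsHermitian := hX.isHermitian.smul (.all ε)
  have hU : ∀ ε : ℝ, (Uop γ M K (ε • X)).IsHermitian := fun ε => Uop_isHermitian γ M hK' (hXε ε)
  have hU0 : Uop γ M K ((0 : ℝ) • X) = γ • 1 := by simp [Uop]
  have hUcont : Continuous fun ε : ℝ => Uop γ M K (ε • X) :=
    (continuous_Uop γ M K).comp (continuous_id.smul continuous_const)
  have hγ1 : (γ • (1 : Matrix (Fin m) (Fin m) ℝ)).PosDef := PosDef.one.smul hγ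
  have hUpos : ∀ᶠ ε : ℝ in 𝓝 0, (Uop γ M K (ε • X)).PosDef :=
    hγ1.eventually_of_tendsto (hU0 ▸ hUcont.tendsto 0) hU
  have hUinv : ContinuousAt (fun ε : ℝ => (Uop γ M K (ε • X))⁻¹) 0 := by
    have hdet : (Uop γ M K ((0 : ℝ) • X)).det ≠ 0 := by
      rw [hU0]
      exact hγ1.det_pos.ne'
    simp only [Matrix.inv_def, Ring.inverse_eq_inv']
    exact (hUcont.matrix_det.continuousAt.inv₀ hdet).smul hUcont.matrix_adjugate.continuousAt
  set S := Sop B N M K X with hS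
  have hF : ∀ᶠ ε : ℝ in 𝓝 0,
      (-(Lop A N K X) - ε • (S * (Uop γ M K (ε • X))⁻¹ * Sᵀ)).PosDef := by
    refine hLX.eventually_of_tendsto ?_ fun ε => hLX.isHermitian.sub (.smul ?_ (.all ε))
    · have hcont : ContinuousAt
          (fun ε : ℝ => -(Lop A N K X) - ε • (S * (Uop γ M K (ε • X))⁻¹ * Sᵀ)) 0 := by
        have hmul : ContinuousAt (fun ε : ℝ => S * (Uop γ M K (ε • X))⁻¹ * Sᵀ) 0 :=
          ContinuousAt.comp (g := fun V => S * V * Sᵀ) (by fun_prop) hUinv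
        exact continuousAt_const.sub (continuousAt_id.smul hmul)
      simpa [ContinuousAt] using hcont
    · simpa using isHermitian_mul_mul_conjTranspose S (hU ε).inv
  obtain ⟨ε, ⟨hUε, hFε⟩, hε⟩ :=
    (((hUpos.and hF).filter_mono nhdsWithin_le_nhds).and
      (self_mem_nhdsWithin : Set.Ioi (0 : ℝ) ∈ 𝓝[>] 0)).exists
  replace hε : 0 < ε := hε
  have hεX : (ε • X).PosDef := hX.smul hε
  have hinv : (ε • X)⁻¹⁻¹ = ε • X :=
    nonsing_inv_nonsing_inv _ ((isUnit_iff_isUnit_det _).mp hεX.isUnit)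
  refine ⟨ε, hε, hεX.inv, hinv.symm ▸ hUε, ?_⟩
  rw [hinv, Lop_smul, Sop_smul, ← hS]
  convert (hFε.smul hε).posSemidef using 1
  simp only [transpose_smul, Matrix.smul_mul, Matrix.mul_smul, smul_sub, smul_neg, neg_add]
  abel
end

section
/- Let T ∈ ℝ^{n×n} be invertible. If P ∈ ℝ^{n×n} is symmetric positive definite with U(P^{-1}) positive definite and L(P^{-1}) + S(P^{-1}) U(P^{-1})^{-1} S(P^{-1})ᵀ ≤ 0, then P_b := T P Tᵀ is symmetric positive definite, U_b(P_b^{-1}) = U(P^{-1}) is positive definite, and L_b(P_b^{-1}) + S_b(P_b^{-1}) U_b(P_b^{-1})^{-1} S_b(P_b^{-1})ᵀ ≤ 0. That is, P_b is a reachability Gramian for the transformed coefficients. -/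
open Matrix

section Congruence

variable {n m q : ℕ} {T : Matrix (Fin n) (Fin n) ℝ}

theorem Matrix.inv_congr_mul_left_cancel (hT : IsUnit T.det)
    (X : Matrix (Fin n) (Fin n) ℝ)
    {l : ℕ} (Y : Matrix (Fin n) (Fin l) ℝ) :
    (T⁻¹)ᵀ * X * T⁻¹ * (T * Y) = (T⁻¹)ᵀ * X * Y := by
  rw [Matrix.mul_assoc _ T⁻¹, nonsing_inv_mul_cancel_left _ _ hT]

theorem Matrix.transpose_mul_inv_congr_cancel (hT : IsUnit T.det)
    (X : Matrix (Fin n) (Fin n) ℝ)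
    {l : ℕ} (Y : Matrix (Fin n) (Fin l) ℝ) :
    (T * Y)ᵀ * ((T⁻¹)ᵀ * X * T⁻¹) = Yᵀ * X * T⁻¹ := by
  have h : Tᵀ * (T⁻¹)ᵀ = 1 := by
    rw [← transpose_mul, nonsing_inv_mul _ hT, transpose_one]
  calc (T * Y)ᵀ * ((T⁻¹)ᵀ * X * T⁻¹) = Yᵀ * (Tᵀ * (T⁻¹)ᵀ) * X * T⁻¹ := by
        simp only [transpose_mul, Matrix.mul_assoc]
    _ = Yᵀ * X * T⁻¹ := by rw [h, Matrix.mul_one]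

theorem Matrix.transpose_mul_inv_congr_mul_cancel (hT : IsUnit T.det)
    (X : Matrix (Fin n) (Fin n) ℝ)
    {k l : ℕ} (Y : Matrix (Fin n) (Fin k) ℝ)
    (Z : Matrix (Fin n) (Fin l) ℝ) :
    (T * Y)ᵀ * ((T⁻¹)ᵀ * X * T⁻¹) * (T * Z) = Yᵀ * X * Z := by
  rw [transpose_mul_inv_congr_cancel hT, Matrix.mul_assoc _ T⁻¹,
    nonsing_inv_mul_cancel_left _ _ hT]

theorem Uop_congr (hT : IsUnit T.det)
    (X : Matrix (Fin n) (Fin n) ℝ)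
    (γ : ℝ) (M : Fin q → Matrix (Fin n) (Fin m) ℝ)
    (K : Matrix (Fin q) (Fin q) ℝ) :
    Uop γ (fun i => T * M i) K ((T⁻¹)ᵀ * X * T⁻¹) = Uop γ M K X := by
  simp only [Uop, transpose_mul_inv_congr_mul_cancel hT]

theorem Sop_congr (hT : IsUnit T.det)
    (X : Matrix (Fin n) (Fin n) ℝ)
    (B : Matrix (Fin n) (Fin m) ℝ) (N : Fin q → Matrix (Fin n) (Fin n) ℝ)
    (M : Fin q → Matrix (Fin n) (Fin m) ℝ) (K : Matrix (Fin q) (Fin q) ℝ) :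
    Sop (T * B) (fun i => T * N i * T⁻¹) (fun i => T * M i) K ((T⁻¹)ᵀ * X * T⁻¹) =
      (T⁻¹)ᵀ * Sop B N M K X := by
  simp only [Sop, Matrix.mul_assoc T, transpose_mul_inv_congr_mul_cancel hT,
    inv_congr_mul_left_cancel hT]
  simp only [Matrix.mul_add, Matrix.mul_sum, Matrix.mul_smul, transpose_mul, Matrix.mul_assoc]

theorem Lop_congr (hT : IsUnit T.det)
    (X : Matrix (Fin n) (Fin n) ℝ)
    (A : Matrix (Fin n) (Fin n) ℝ) (N : Fin q → Matrix (Fin n) (Fin n) ℝ)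
    (K : Matrix (Fin q) (Fin q) ℝ) :
    Lop (T * A * T⁻¹) (fun i => T * N i * T⁻¹) K ((T⁻¹)ᵀ * X * T⁻¹) =
      (T⁻¹)ᵀ * Lop A N K X * T⁻¹ := by
  simp only [Lop, Matrix.mul_assoc T, inv_congr_mul_left_cancel hT,
    transpose_mul_inv_congr_cancel hT]
  simp only [Matrix.mul_add, Matrix.add_mul, Matrix.mul_sum, Matrix.sum_mul, Matrix.mul_smul,
    Matrix.smul_mul, transpose_mul, Matrix.mul_assoc, nonsing_inv_mul_cancel_left _ _ hT]

end Congruence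

/-- If `T` is invertible and `P` is a reachability Gramian (symmetric positive
definite, `U(P⁻¹) > 0` and `L(P⁻¹) + S(P⁻¹) U(P⁻¹)⁻¹ S(P⁻¹)ᵀ ≤ 0`), then `P_b := T P Tᵀ` is a
reachability Gramian for the transformed coefficients `A_b = TAT⁻¹`, `B_b = TB`, `M_{i,b} = TM_i`,
`N_{i,b} = TN_iT⁻¹`, and moreover `U_b(P_b⁻¹) = U(P⁻¹)`. -/
theorem reachability_gramian_transformed {n m q : ℕ} [NeZero n] [NeZero m] [NeZero q]
    (A : Matrix (Fin n) (Fin n) ℝ) (N : Fin q → Matrix (Fin n) (Fin n) ℝ)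
    (B : Matrix (Fin n) (Fin m) ℝ) (M : Fin q → Matrix (Fin n) (Fin m) ℝ)
    (K : Matrix (Fin q) (Fin q) ℝ) (hK : K.PosSemidef)
    (γ : ℝ) (hγ : 0 < γ)
    (T : Matrix (Fin n) (Fin n) ℝ) (hT : IsUnit T.det)
    (P : Matrix (Fin n) (Fin n) ℝ) (hP : P.PosDef)
    (hU : (Uop γ M K P⁻¹).PosDef)
    (hIneq : (-(Lop A N K P⁻¹ +
        Sop B N M K P⁻¹ * (Uop γ M K P⁻¹)⁻¹ * (Sop B N M K P⁻¹)ᵀ)).PosSemidef) :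
    (T * P * Tᵀ).PosDef ∧
    Uop γ (fun i => T * M i) K (T * P * Tᵀ)⁻¹ = Uop γ M K P⁻¹ ∧
    (Uop γ (fun i => T * M i) K (T * P * Tᵀ)⁻¹).PosDef ∧
    (-(Lop (T * A * T⁻¹) (fun i => T * N i * T⁻¹) K (T * P * Tᵀ)⁻¹ +
        Sop (T * B) (fun i => T * N i * T⁻¹) (fun i => T * M i) K (T * P * Tᵀ)⁻¹ *
          (Uop γ (fun i => T * M i) K (T * P * Tᵀ)⁻¹)⁻¹ *
          (Sop (T * B) (fun i => T * N i * T⁻¹) (fun i => T * M i) K (T * P * Tᵀ)⁻¹)ᵀ)).PosSemidef := by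
  have hinv : (T * P * Tᵀ)⁻¹ = (T⁻¹)ᵀ * P⁻¹ * T⁻¹ := by
    rw [Matrix.mul_inv_rev, Matrix.mul_inv_rev, transpose_nonsing_inv, Matrix.mul_assoc]
  rw [hinv, Uop_congr hT, Sop_congr hT, Lop_congr hT]
  refine ⟨?_, rfl, hU, ?_⟩
  · rw [← conjTranspose_eq_transpose_of_trivial]
    exact hP.mul_mul_conjTranspose_same
      (vecMul_injective_of_isUnit ((isUnit_iff_isUnit_det T).2 hT))
  · convert hIneq.conjTranspose_mul_mul_same T⁻¹ using 1
    simp only [conjTranspose_eq_transpose_of_trivial, transpose_mul, transpose_transpose,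
      Matrix.mul_add, Matrix.add_mul, Matrix.mul_neg, Matrix.neg_mul, Matrix.mul_assoc]
end
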